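/- arXiv:1702.08380 — 6 statements merged into one kernel-verified Lean document; each statement's English description precedes it below -/
import Mathlib

section
/- A polygonal path P in the plane is increasing-chord if and only if the following normal condition holds: for every segment [v_i, v_{i+1}] of P and every point v on that segment, every point a on P occurring at or before v in the parametrization satisfies (a − v)·(v_{i+1} − v_i) ≤ 0, and every point d on P occurring at or after v satisfies (d − v)·(v_{i+1} − v_i) ≥ 0 (equivalently, the line through v perpendicular to the segment of P containing v does not properly intersect P except at v). -/
open RealInnerProductSpace

noncomputable section

/-- The Euclidean plane `ℝ²`. -/
abbrev E2 : Type := EuclideanSpace ℝ (Fin 2)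

/-- The point of `ℝ²` with coordinates `x`, `y`. -/
def pt (x y : ℝ) : E2 := (WithLp.equiv 2 (Fin 2 → ℝ)).symm ![x, y]

/-- The piecewise-linear parametrization of the polygonal path with vertices
`v 0, v 1, …` : for `t ∈ [i, i+1]` it traverses the segment `[v i, v (i+1)]` linearly. -/
def polyPath (v : ℕ → E2) (t : ℝ) : E2 :=
  v ⌊t⌋₊ + (t - (⌊t⌋₊ : ℝ)) • (v (⌊t⌋₊ + 1) - v ⌊t⌋₊)

/-- The polygonal path with vertices `v 0, …, v n` is increasing-chord: for parameter
positions `a ⪯ b ⪯ c ⪯ d` in `[0, n]`, the distance between the points at `b` and `c`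
is at most the distance between the points at `a` and `d`. -/
def IncreasingChord (n : ℕ) (v : ℕ → E2) : Prop :=
  ∀ a b c d : ℝ, 0 ≤ a → a ≤ b → b ≤ c → c ≤ d → d ≤ (n : ℝ) →
    dist (polyPath v b) (polyPath v c) ≤ dist (polyPath v a) (polyPath v d)

/-- On the parameter interval `[i, i + 1]` the path is affine with direction `v (i + 1) - v i`. -/
theorem polyPath_eq_of_mem_Icc (v : ℕ → E2) {i : ℕ} {t : ℝ} (ht : t ∈ Set.Icc (i : ℝ) (i + 1)) :
    polyPath v t = v i + (t - i) • (v (i + 1) - v i) := by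
  obtain rfl | hlt := ht.2.eq_or_lt
  · have hfloor : ⌊(i : ℝ) + 1⌋₊ = i + 1 := by exact_mod_cast Nat.floor_natCast (R := ℝ) (i + 1)
    simp [polyPath, hfloor]
  · have hfloor : ⌊t⌋₊ = i := (Nat.floor_eq_iff (i.cast_nonneg.trans ht.1)).2 ⟨ht.1, hlt⟩
    simp [polyPath, hfloor]

theorem polyPath_sub_polyPath (v : ℕ → E2) {i : ℕ} {s t : ℝ}
    (hs : s ∈ Set.Icc (i : ℝ) (i + 1)) (ht : t ∈ Set.Icc (i : ℝ) (i + 1)) :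
    polyPath v t - polyPath v s = (t - s) • (v (i + 1) - v i) := by
  rw [polyPath_eq_of_mem_Icc v hs, polyPath_eq_of_mem_Icc v ht]
  module

section InnerProductSpace

variable {V : Type*} [NormedAddCommGroup V] [InnerProductSpace ℝ V]

theorem norm_add_smul_sq_real (x y : V) (r : ℝ) :
    ‖x + r • y‖ ^ 2 = ‖x‖ ^ 2 + 2 * r * ⟪x, y⟫ + r ^ 2 * ‖y‖ ^ 2 := by
  rw [norm_add_sq_real, inner_smul_right, norm_smul, mul_pow, Real.norm_eq_abs, sq_abs]
  ring

theorem norm_le_norm_add_smul {x y : V} {r : ℝ} (hr : 0 ≤ r) (h : 0 ≤ ⟪x, y⟫) :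
    ‖x‖ ≤ ‖x + r • y‖ := by
  refine le_of_sq_le_sq ?_ (norm_nonneg _)
  rw [norm_add_smul_sq_real]
  nlinarith [mul_nonneg hr h, mul_nonneg (sq_nonneg r) (sq_nonneg ‖y‖)]

theorem inner_nonneg_of_norm_sub_smul_le {x y : V} {r : ℝ} (hr : 0 < r)
    (h : ‖x - r • y‖ ≤ ‖x‖) : 0 ≤ ⟪x, y⟫ := by
  have hsq := pow_le_pow_left₀ (norm_nonneg _) h 2
  rw [sub_eq_add_neg, ← neg_smul, norm_add_smul_sq_real] at hsq
  have : 0 ≤ r * ⟪x, y⟫ := by nlinarith [mul_nonneg (sq_nonneg r) (sq_nonneg ‖y‖)]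
  exact nonneg_of_mul_nonneg_right this hr

theorem inner_nonneg_of_norm_le_norm_add_smul {x y : V}
    (h : ∀ r : ℝ, 0 < r → r ≤ 1 → ‖x‖ ≤ ‖x + r • y‖) : 0 ≤ ⟪x, y⟫ := by
  have hbound : ∀ r : ℝ, 0 < r → r ≤ 1 → 0 ≤ 2 * ⟪x, y⟫ + r * ‖y‖ ^ 2 := by
    intro r hr hr1
    have hsq := pow_le_pow_left₀ (norm_nonneg _) (h r hr hr1) 2
    rw [norm_add_smul_sq_real] at hsq
    have : 0 ≤ r * (2 * ⟪x, y⟫ + r * ‖y‖ ^ 2) := by nlinarith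
    exact nonneg_of_mul_nonneg_right this hr
  have hlim : Filter.Tendsto (fun r : ℝ => 2 * ⟪x, y⟫ + r * ‖y‖ ^ 2)
      (nhdsWithin 0 (Set.Ioi 0)) (nhds (2 * ⟪x, y⟫ + 0 * ‖y‖ ^ 2)) :=
    (Continuous.tendsto (by fun_prop) 0).mono_left nhdsWithin_le_nhds
  have hlimit := ge_of_tendsto hlim (Filter.eventually_of_mem
    (Ioc_mem_nhdsGT zero_lt_one) fun r hr => hbound r hr.1 hr.2)
  linarith

end InnerProductSpace

/-- A function that is monotone on each piece `s ∩ [i, i + 1]`, `i < n`, of an order-connected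
set `s` is monotone on `s ∩ [0, n]`. -/
theorem monotoneOn_inter_Icc_zero_natCast {f : ℝ → ℝ} {s : Set ℝ} (hs : s.OrdConnected) {n : ℕ}
    (h : ∀ i < n, MonotoneOn f (s ∩ Set.Icc (i : ℝ) (i + 1))) :
    MonotoneOn f (s ∩ Set.Icc 0 (n : ℝ)) := by
  induction n with
  | zero =>
    rintro x ⟨-, hx0, hx1⟩ y ⟨-, hy0, hy1⟩ -
    rw [Nat.cast_zero] at hx1 hy1
    rw [le_antisymm hx1 hx0, le_antisymm hy1 hy0]
  | succ m ih =>
    have hprev := ih fun i hi => h i (hi.trans m.lt_succ_self)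
    have hlast := h m m.lt_succ_self
    rintro x ⟨hxs, hx0, hx1⟩ y ⟨hys, hy0, hy1⟩ hxy
    push_cast at hx1 hy1
    obtain hym | hmy := le_total y m
    · exact hprev ⟨hxs, hx0, hxy.trans hym⟩ ⟨hys, hy0, hym⟩ hxy
    obtain hxm | hmx := le_total x m
    · have hms : (m : ℝ) ∈ s := hs.out hxs hys ⟨hxm, hmy⟩
      exact (hprev ⟨hxs, hx0, hxm⟩ ⟨hms, m.cast_nonneg, le_rfl⟩ hxm).trans
        (hlast ⟨hms, le_rfl, by linarith⟩ ⟨hys, hmy, hy1⟩ hmy)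
    · exact hlast ⟨hxs, hmx, hx1⟩ ⟨hys, hmy, hy1⟩ hxy

/-- In an increasing-chord path, every point after a given one lies in the forward half-plane. -/
theorem IncreasingChord.inner_nonneg_of_le {n : ℕ} {v : ℕ → E2} (h : IncreasingChord n v)
    {i : ℕ} {t s : ℝ} (ht : t ∈ Set.Icc (i : ℝ) (i + 1)) (hts : t ≤ s) (hsn : s ≤ n) :
    0 ≤ ⟪polyPath v s - polyPath v t, v (i + 1) - v i⟫ := by
  have hi0 : (0 : ℝ) ≤ i := i.cast_nonneg
  obtain rfl | hlt := hts.eq_or_lt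
  · simp
  obtain rfl | ht1 := ht.2.eq_or_lt
  · refine inner_nonneg_of_norm_le_norm_add_smul fun r hr hr1 => ?_
    have hr' : (i : ℝ) + 1 - r ∈ Set.Icc (i : ℝ) (i + 1) := ⟨by linarith, by linarith⟩
    have hchord := h (i + 1 - r) (i + 1) s s (by linarith) (by linarith) hts le_rfl hsn
    have hdiff := polyPath_sub_polyPath v hr' ht
    rw [sub_sub_cancel] at hdiff
    rwa [← hdiff, sub_add_sub_cancel, ← dist_eq_norm, ← dist_eq_norm, dist_comm,
      dist_comm (polyPath v s)]
  · have hmin : t < min ((i : ℝ) + 1) s := lt_min ht1 hlt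
    have hm : min ((i : ℝ) + 1) s ∈ Set.Icc (i : ℝ) (i + 1) :=
      ⟨ht.1.trans hmin.le, min_le_left _ _⟩
    refine inner_nonneg_of_norm_sub_smul_le (sub_pos.2 hmin) ?_
    have hchord := h t _ s s (hi0.trans ht.1) hmin.le (min_le_right _ _) le_rfl hsn
    rwa [← polyPath_sub_polyPath v ht hm, sub_sub_sub_cancel_right, ← dist_eq_norm,
      ← dist_eq_norm, dist_comm, dist_comm (polyPath v s)]

/-- In an increasing-chord path, every point before a given one lies in the backward
half-plane. -/
theorem IncreasingChord.inner_nonpos_of_le {n : ℕ} {v : ℕ → E2} (h : IncreasingChord n v)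
    {i : ℕ} (hin : i < n) {t s : ℝ} (ht : t ∈ Set.Icc (i : ℝ) (i + 1)) (hs0 : 0 ≤ s)
    (hst : s ≤ t) : ⟪polyPath v s - polyPath v t, v (i + 1) - v i⟫ ≤ 0 := by
  have hn : (i : ℝ) + 1 ≤ n := by exact_mod_cast hin
  rw [← neg_sub, inner_neg_left, neg_nonpos]
  obtain rfl | hlt := hst.eq_or_lt
  · simp
  obtain rfl | hit := ht.1.eq_or_lt
  · refine inner_nonneg_of_norm_le_norm_add_smul fun r hr hr1 => ?_
    have hr' : (i : ℝ) + r ∈ Set.Icc (i : ℝ) (i + 1) := ⟨by linarith, by linarith⟩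
    have hchord := h s s i (i + r) hs0 le_rfl hst (by linarith) (by linarith)
    have hdiff := polyPath_sub_polyPath v ht hr'
    rw [add_sub_cancel_left] at hdiff
    rwa [← hdiff, sub_add_sub_cancel', ← dist_eq_norm, ← dist_eq_norm, dist_comm,
      dist_comm _ (polyPath v s)]
  · have hmax : max (i : ℝ) s < t := max_lt hit hlt
    have hm : max (i : ℝ) s ∈ Set.Icc (i : ℝ) (i + 1) :=
      ⟨le_max_left _ _, hmax.le.trans ht.2⟩
    refine inner_nonneg_of_norm_sub_smul_le (sub_pos.2 hmax) ?_
    have hchord := h s s _ t hs0 le_rfl (le_max_right _ _) hmax.le (ht.2.trans hn)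
    rwa [← polyPath_sub_polyPath v hm ht, sub_sub_sub_cancel_left, ← dist_eq_norm,
      ← dist_eq_norm, dist_comm, dist_comm _ (polyPath v s)]

/-- If every earlier point lies in the backward half-plane, then the distance to a fixed point of
the path increases along the rest of the path. -/
theorem monotoneOn_dist_polyPath {n : ℕ} {v : ℕ → E2} {a : ℝ}
    (h : ∀ i < n, ∀ t ∈ Set.Icc (i : ℝ) (i + 1), a ≤ t →
      ⟪polyPath v a - polyPath v t, v (i + 1) - v i⟫ ≤ 0) :
    MonotoneOn (fun t => dist (polyPath v a) (polyPath v t)) (Set.Ici a ∩ Set.Icc 0 (n : ℝ)) := by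
  refine monotoneOn_inter_Icc_zero_natCast Set.ordConnected_Ici ?_
  rintro i hi x ⟨hax, hx⟩ y ⟨-, hy⟩ hxy
  have hinner : 0 ≤ ⟪polyPath v x - polyPath v a, v (i + 1) - v i⟫ := by
    rw [← neg_sub, inner_neg_left, neg_nonneg]
    exact h i hi x hx hax
  have hnorm := norm_le_norm_add_smul (sub_nonneg.2 hxy) hinner
  rwa [← polyPath_sub_polyPath v hx hy, sub_add_sub_cancel', ← dist_eq_norm, ← dist_eq_norm,
    dist_comm, dist_comm _ (polyPath v a)] at hnorm

/-- If every later point lies in the forward half-plane, then the distance to a fixed point of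
the path decreases along the path up to that point. -/
theorem antitoneOn_dist_polyPath {n : ℕ} {v : ℕ → E2} {d : ℝ}
    (h : ∀ i < n, ∀ t ∈ Set.Icc (i : ℝ) (i + 1), t ≤ d →
      0 ≤ ⟪polyPath v d - polyPath v t, v (i + 1) - v i⟫) :
    AntitoneOn (fun t => dist (polyPath v t) (polyPath v d)) (Set.Iic d ∩ Set.Icc 0 (n : ℝ)) := by
  suffices hmono : MonotoneOn (fun t => -dist (polyPath v t) (polyPath v d))
      (Set.Iic d ∩ Set.Icc 0 (n : ℝ)) from
    fun x hx y hy hxy => neg_le_neg_iff.1 (hmono hx hy hxy)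
  refine monotoneOn_inter_Icc_zero_natCast Set.ordConnected_Iic ?_
  rintro i hi x ⟨-, hx⟩ y ⟨hyd, hy⟩ hxy
  have hnorm := norm_le_norm_add_smul (sub_nonneg.2 hxy) (h i hi y hy hyd)
  rw [← polyPath_sub_polyPath v hx hy, sub_add_sub_cancel, ← dist_eq_norm, ← dist_eq_norm,
    dist_comm, dist_comm (polyPath v d)] at hnorm
  exact neg_le_neg hnorm

/-- A polygonal path is increasing-chord iff the normal condition of
Icking et al. holds: for every segment `[v i, v (i+1)]` and every point on it (parameter
`i + u`, `u ∈ [0,1]`), every earlier point of the path lies in the closed half-plane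
`⟪· - point, v (i+1) - v i⟫ ≤ 0` and every later point lies in the opposite closed
half-plane. -/
theorem increasingChord_iff_normal_condition (n : ℕ) (v : ℕ → E2)
    (hdist : ∀ i < n, v i ≠ v (i + 1)) :
    IncreasingChord n v ↔
      ∀ i : ℕ, i < n → ∀ u : ℝ, 0 ≤ u → u ≤ 1 →
        (∀ s : ℝ, 0 ≤ s → s ≤ (i : ℝ) + u →
          ⟪polyPath v s - polyPath v ((i : ℝ) + u), v (i + 1) - v i⟫ ≤ 0) ∧
        (∀ s : ℝ, (i : ℝ) + u ≤ s → s ≤ (n : ℝ) →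
          0 ≤ ⟪polyPath v s - polyPath v ((i : ℝ) + u), v (i + 1) - v i⟫) := by
  constructor
  · intro h i hi u hu0 hu1
    have ht : (i : ℝ) + u ∈ Set.Icc (i : ℝ) (i + 1) := ⟨by linarith, by linarith⟩
    exact ⟨fun s hs0 hst => h.inner_nonpos_of_le hi ht hs0 hst,
      fun s hts hsn => h.inner_nonneg_of_le ht hts hsn⟩
  · intro h a b c d ha hab hbc hcd hdn
    have hbefore : ∀ i < n, ∀ t ∈ Set.Icc (i : ℝ) (i + 1), a ≤ t →
        ⟪polyPath v a - polyPath v t, v (i + 1) - v i⟫ ≤ 0 := by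
      intro i hi t ht hat
      have hnormal := (h i hi (t - i) (by linarith [ht.1]) (by linarith [ht.2])).1 a ha
      rw [add_sub_cancel] at hnormal
      exact hnormal hat
    have hafter : ∀ i < n, ∀ t ∈ Set.Icc (i : ℝ) (i + 1), t ≤ c →
        0 ≤ ⟪polyPath v c - polyPath v t, v (i + 1) - v i⟫ := by
      intro i hi t ht htc
      have hnormal := (h i hi (t - i) (by linarith [ht.1]) (by linarith [ht.2])).2 c
      rw [add_sub_cancel] at hnormal
      exact hnormal htc (hcd.trans hdn)
    have hcn : c ≤ n := hcd.trans hdn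
    have hc0 : 0 ≤ c := ha.trans (hab.trans hbc)
    calc dist (polyPath v b) (polyPath v c)
        ≤ dist (polyPath v a) (polyPath v c) :=
          antitoneOn_dist_polyPath hafter ⟨hab.trans hbc, ha, (hab.trans hbc).trans hcn⟩
            ⟨hbc, ha.trans hab, hbc.trans hcn⟩ hab
      _ ≤ dist (polyPath v a) (polyPath v d) :=
          monotoneOn_dist_polyPath hbefore ⟨hab.trans hbc, hc0, hcn⟩
            ⟨(hab.trans hbc).trans hcd, hc0.trans hcd, hdn⟩ hcd
end
end

section
/- Let P be a polygonal path with vertices v₀, v₁, …, vₙ in the plane. If there exist two orthogonal unit vectors e₁ and e₂ in ℝ² such that every edge vector v_{i+1} − v_i (0 ≤ i < n) has nonnegative inner product with both e₁ and e₂ (i.e., all edge directions lie in a closed wedge of angular width at most 90°), then P is an increasing-chord path. -/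
open RealInnerProductSpace

noncomputable section

/-- On each step of the path, the inner product with `e` of the point at `t` is the affine
interpolation of the inner products at the two ends of the edge. -/
lemma inner_polyPath (v : ℕ → E2) (e : E2) (t : ℝ) :
    ⟪polyPath v t, e⟫ = ⟪v ⌊t⌋₊, e⟫ + (t - ⌊t⌋₊) * ⟪v (⌊t⌋₊ + 1) - v ⌊t⌋₊, e⟫ := by
  rw [polyPath, inner_add_left, real_inner_smul_left]

/-- If every edge has nonnegative inner product with `e`, then the inner product with `e` is
monotone along the path. -/
lemma inner_polyPath_mono {n : ℕ} {v : ℕ → E2} {e : E2}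
    (hedge : ∀ i < n, 0 ≤ ⟪v (i + 1) - v i, e⟫) {s t : ℝ} (hs : 0 ≤ s) (hst : s ≤ t)
    (ht : t ≤ n) : ⟪polyPath v s, e⟫ ≤ ⟪polyPath v t, e⟫ := by
  have hvert : ∀ i j : ℕ, i ≤ j → j ≤ n → ⟪v i, e⟫ ≤ ⟪v j, e⟫ := by
    intro i j hij
    induction j, hij using Nat.le_induction with
    | base => exact fun _ => le_rfl
    | succ j _ ih =>
      intro hj
      have hstep := hedge j hj
      rw [inner_sub_left] at hstep
      linarith [ih (by omega)]
  have hs₁ := Nat.floor_le hs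
  have hs₂ := Nat.lt_floor_add_one s
  have ht₁ := Nat.floor_le (hs.trans hst)
  have htn : ⌊t⌋₊ ≤ n := Nat.floor_le_of_le ht
  rw [inner_polyPath, inner_polyPath]
  rcases (Nat.floor_mono hst).eq_or_lt with heq | hlt
  · rw [heq]
    rcases htn.eq_or_lt with hn | hn
    · have hcast : (⌊t⌋₊ : ℝ) = n := by exact_mod_cast hn
      rw [heq] at hs₁
      have hts : s = t := by linarith
      rw [hts]
    · have := hedge _ hn
      gcongr
  · have hfrom : ⟪v ⌊s⌋₊, e⟫ + (s - ⌊s⌋₊) * ⟪v (⌊s⌋₊ + 1) - v ⌊s⌋₊, e⟫ ≤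
        ⟪v (⌊s⌋₊ + 1), e⟫ := by
      have hle := mul_le_of_le_one_left (hedge ⌊s⌋₊ (by omega))
        (show s - ⌊s⌋₊ ≤ 1 by linarith)
      have hsub := inner_sub_left (𝕜 := ℝ) (v (⌊s⌋₊ + 1)) (v ⌊s⌋₊) e
      linarith
    have hto : 0 ≤ (t - ⌊t⌋₊) * ⟪v (⌊t⌋₊ + 1) - v ⌊t⌋₊, e⟫ := by
      rcases htn.eq_or_lt with hn | hn
      · have hcast : (⌊t⌋₊ : ℝ) = n := by exact_mod_cast hn
        rw [show t - ⌊t⌋₊ = 0 by linarith, zero_mul]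
      · exact mul_nonneg (by linarith) (hedge _ hn)
    linarith [hvert (⌊s⌋₊ + 1) ⌊t⌋₊ hlt htn]

/-- The Pythagorean theorem in the orthonormal frame `e₁`, `e₂` of the plane. -/
lemma norm_sq_eq_inner_sq_add_inner_sq {e₁ e₂ : E2} (he₁ : ‖e₁‖ = 1) (he₂ : ‖e₂‖ = 1)
    (horth : ⟪e₁, e₂⟫ = 0) (x : E2) : ‖x‖ ^ 2 = ⟪x, e₁⟫ ^ 2 + ⟪x, e₂⟫ ^ 2 := by
  have hon : Orthonormal ℝ ![e₁, e₂] := by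
    rw [orthonormal_vecCons_iff]
    simp [he₁, he₂, horth]
  let b := (basisOfOrthonormalOfCardEqFinrank hon (by simp)).toOrthonormalBasis (by simpa using hon)
  simpa [b, Fin.sum_univ_two] using (b.sum_sq_norm_inner_left x).symm

/-- If there are two orthogonal unit vectors `e₁`, `e₂` such that every
edge vector of the polygonal path has nonnegative inner product with both (all edge
directions lie in a closed wedge of angular width at most `90°`), then the path is
increasing-chord. -/
theorem increasingChord_of_wedge (n : ℕ) (v : ℕ → E2)
    (hdist : ∀ i < n, v i ≠ v (i + 1))
    (e₁ e₂ : E2) (he₁ : ‖e₁‖ = 1) (he₂ : ‖e₂‖ = 1) (horth : ⟪e₁, e₂⟫ = 0)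
    (hwedge : ∀ i < n, 0 ≤ ⟪v (i + 1) - v i, e₁⟫ ∧ 0 ≤ ⟪v (i + 1) - v i, e₂⟫) :
    IncreasingChord n v := by
  intro a b c d ha hab hbc hcd hd
  have hproj : ∀ e : E2, (∀ i < n, 0 ≤ ⟪v (i + 1) - v i, e⟫) →
      ⟪polyPath v c - polyPath v b, e⟫ ^ 2 ≤ ⟪polyPath v d - polyPath v a, e⟫ ^ 2 := by
    intro e he
    have h₁ := inner_polyPath_mono he ha hab (by linarith)
    have h₂ := inner_polyPath_mono he (by linarith) hbc (by linarith)
    have h₃ := inner_polyPath_mono he (by linarith) hcd hd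
    rw [inner_sub_left, inner_sub_left]
    exact pow_le_pow_left₀ (by linarith) (by linarith) 2
  rw [dist_comm, dist_comm (polyPath v a), dist_eq_norm, dist_eq_norm,
    ← sq_le_sq₀ (norm_nonneg _) (norm_nonneg _),
    norm_sq_eq_inner_sq_add_inner_sq he₁ he₂ horth, norm_sq_eq_inner_sq_add_inner_sq he₁ he₂ horth]
  exact add_le_add (hproj e₁ fun i hi => (hwedge i hi).1) (hproj e₂ fun i hi => (hwedge i hi).2)
end
end

section
/- Let P be a polygonal path in the plane having three consecutive vertices u, v, w (so [u,v] and [v,w] are consecutive segments of P, with u ≠ v and w ≠ v). If (u − v)·(w − v) > 0, i.e., the two segments meet at v at an interior angle strictly less than 90°, then P is not an increasing-chord path. -/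
open RealInnerProductSpace

noncomputable section

/-- On the half-open parameter interval `[k, k + 1)` the path runs along `[v k, v (k + 1)]`. -/
theorem polyPath_natCast_add (v : ℕ → E2) (k : ℕ) {s : ℝ} (hs₀ : 0 ≤ s) (hs₁ : s < 1) :
    polyPath v (k + s) = v k + s • (v (k + 1) - v k) := by
  have hfloor : ⌊(k : ℝ) + s⌋₊ = k := by
    rw [Nat.floor_eq_iff (by positivity)]
    constructor <;> linarith
  simp [polyPath, hfloor]

/-- The path passes through its vertices at natural parameters. -/
theorem polyPath_natCast (v : ℕ → E2) (k : ℕ) : polyPath v k = v k := by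
  simp [polyPath]

/-- If `x` and `y` span an acute angle, moving from the origin slightly along `y` decreases the
distance to `x`. -/
theorem exists_norm_sub_smul_lt {E : Type*} [NormedAddCommGroup E] [InnerProductSpace ℝ E]
    {x y : E} (h : 0 < ⟪x, y⟫) : ∃ s : ℝ, 0 ≤ s ∧ s < 1 ∧ ‖x - s • y‖ < ‖x‖ := by
  have hy : 0 < ‖y‖ := norm_pos_iff.2 (by rintro rfl; simp at h)
  have hy2 : 0 < ‖y‖ ^ 2 := by positivity
  have hden : 0 < ⟪x, y⟫ + ‖y‖ ^ 2 := by positivity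
  set s : ℝ := ⟪x, y⟫ / (⟪x, y⟫ + ‖y‖ ^ 2)
  have hs₀ : 0 < s := div_pos h hden
  have hmul : s * (⟪x, y⟫ + ‖y‖ ^ 2) = ⟪x, y⟫ := div_mul_cancel₀ _ hden.ne'
  refine ⟨s, hs₀.le, (div_lt_one hden).2 (by linarith), ?_⟩
  refine lt_of_pow_lt_pow_left₀ 2 (norm_nonneg _) ?_
  rw [norm_sub_sq_real, real_inner_smul_right, norm_smul, mul_pow, Real.norm_eq_abs, sq_abs]
  nlinarith [mul_pos hs₀ h, mul_pos hs₀ (mul_pos hs₀ h)]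

/-- If a polygonal path has three consecutive vertices
`u = v i`, `v (i+1)`, `w = v (i+2)` with `⟪u - v (i+1), w - v (i+1)⟫ > 0`
(interior angle strictly less than `90°`), then the path is not increasing-chord. -/
theorem not_increasingChord_of_sharp_angle (n : ℕ) (v : ℕ → E2)
    (hdist : ∀ i < n, v i ≠ v (i + 1))
    (i : ℕ) (hi : i + 2 ≤ n)
    (hangle : 0 < ⟪v i - v (i + 1), v (i + 2) - v (i + 1)⟫) :
    ¬ IncreasingChord n v := by
  intro hchord
  obtain ⟨s, hs₀, hs₁, hlt⟩ := exists_norm_sub_smul_lt hangle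
  have hn : (i : ℝ) + 2 ≤ n := by exact_mod_cast hi
  have hle := hchord i i (i + 1 : ℕ) ((i + 1 : ℕ) + s) i.cast_nonneg le_rfl
    (by simp) (by linarith) (by push_cast; linarith)
  rw [polyPath_natCast_add v (i + 1) hs₀ hs₁, polyPath_natCast, polyPath_natCast,
    dist_eq_norm, dist_eq_norm, ← sub_sub] at hle
  exact hle.not_gt hlt
end
end

section
/- For every integer α ≥ 1 and every integer i with 1 ≤ i ≤ 2α − 1, the vertical distance between the intersection points of L_i and L_{i+1} with the vertical line x = 2α + 1 is at least 1/α; that is, (i+1)²/(2α − i) − i²/(2α − i + 1) ≥ 1/α. -/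
/-- For integers `α ≥ 1` and `1 ≤ i ≤ 2α − 1`, the vertical distance
between the intersections of `L i` and `L (i+1)` with the line `x = 2α + 1` is at least
`1/α`: `(i+1)²/(2α − i) − i²/(2α − i + 1) ≥ 1/α`. -/
theorem consecutive_intersections_gap (α i : ℕ) (hα : 1 ≤ α)
    (hi₁ : 1 ≤ i) (hi₂ : i ≤ 2 * α - 1) :
    1 / (α : ℝ) ≤
      ((i : ℝ) + 1) ^ 2 / (2 * (α : ℝ) - (i : ℝ))
        - (i : ℝ) ^ 2 / (2 * (α : ℝ) - (i : ℝ) + 1) := by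
  have hα' : (1 : ℝ) ≤ α := by exact_mod_cast hα
  have hi : (1 : ℝ) ≤ i := by exact_mod_cast hi₁
  have hm : (0 : ℝ) < 2 * (α : ℝ) - i := by
    have h : i < 2 * α := by omega
    have h' : (i : ℝ) < 2 * α := by exact_mod_cast h
    linarith
  have hdrop : (i : ℝ) ^ 2 / (2 * (α : ℝ) - i + 1) ≤ (i : ℝ) ^ 2 / (2 * (α : ℝ) - i) :=
    div_le_div_of_nonneg_left (by positivity) hm (by linarith)
  have hmain : 1 / (α : ℝ) ≤ (2 * (i : ℝ) + 1) / (2 * (α : ℝ) - i) := by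
    rw [div_le_div_iff₀ (by linarith) hm]
    nlinarith
  have hsplit : ((i : ℝ) + 1) ^ 2 / (2 * (α : ℝ) - i) =
      (i : ℝ) ^ 2 / (2 * (α : ℝ) - i) + (2 * (i : ℝ) + 1) / (2 * (α : ℝ) - i) := by
    rw [← add_div]
    ring
  linarith
end

section
/- For every integer α ≥ 1 and every integer i with 1 ≤ i ≤ 2α, the line L_i appears on the upper envelope of the arrangement of the lines L_1, …, L_{2α}: there exists a real number x with 0 ≤ x ≤ 2α + 1 such that ℓ_i(x) > ℓ_j(x) for every j ≠ i with 1 ≤ j ≤ 2α. -/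
noncomputable section

/-- The line `L k` (through `(0, k)` and `(2α − k + 1, 0)`) as a graph of a function
of `x`: `ℓ_k(x) = k − (k/(2α − k + 1))·x`. -/
def envLine (α k : ℕ) (x : ℝ) : ℝ :=
  (k : ℝ) - ((k : ℝ) / (2 * (α : ℝ) - (k : ℝ) + 1)) * x

/-- At `x = a² / N` with `N = 2α + 1` and `a = N - i`, the line `L i` exceeds `L j` by
`(a - b)² / b`, where `b = N - j`. -/
theorem envLine_sub_envLine (α i j : ℕ) (hi : i ≤ 2 * α) (hj : j ≤ 2 * α) :
    envLine α i ((2 * (α : ℝ) - i + 1) ^ 2 / (2 * α + 1)) -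
      envLine α j ((2 * (α : ℝ) - i + 1) ^ 2 / (2 * α + 1)) =
    ((i : ℝ) - j) ^ 2 / (2 * α - j + 1) := by
  have hi' : (i : ℝ) ≤ 2 * α := by exact_mod_cast hi
  have hj' : (j : ℝ) ≤ 2 * α := by exact_mod_cast hj
  have ha : 2 * (α : ℝ) - i + 1 ≠ 0 := by linarith
  have hb : 2 * (α : ℝ) - j + 1 ≠ 0 := by linarith
  have hN : 2 * (α : ℝ) + 1 ≠ 0 := by positivity
  unfold envLine
  field_simp
  ring

/-- For integers `α ≥ 1` and `1 ≤ i ≤ 2α`, the line `L i` appears on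
the upper envelope of the arrangement of `L 1, …, L (2α)`: there is an abscissa
`x ∈ [0, 2α + 1]` where `ℓ_i` is strictly above all the other lines. -/
theorem Li_on_upper_envelope (α i : ℕ) (hα : 1 ≤ α) (hi₁ : 1 ≤ i) (hi₂ : i ≤ 2 * α) :
    ∃ x : ℝ, 0 ≤ x ∧ x ≤ 2 * (α : ℝ) + 1 ∧
      ∀ j : ℕ, 1 ≤ j → j ≤ 2 * α → j ≠ i → envLine α j x < envLine α i x := by
  have hi' : (i : ℝ) ≤ 2 * α := by exact_mod_cast hi₂
  have hN : 0 < 2 * (α : ℝ) + 1 := by positivity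
  refine ⟨(2 * (α : ℝ) - i + 1) ^ 2 / (2 * α + 1), by positivity, ?_, fun j _ hj hji => ?_⟩
  · rw [div_le_iff₀ hN]
    have hi₀ : (0 : ℝ) ≤ i := i.cast_nonneg
    nlinarith
  · rw [← sub_pos, envLine_sub_envLine α i j hi₂ hj]
    have hj' : (j : ℝ) ≤ 2 * α := by exact_mod_cast hj
    have hne : (i : ℝ) - j ≠ 0 := sub_ne_zero.mpr (by exact_mod_cast hji.symm)
    exact div_pos (by positivity) (by linarith)
end
end

section
/- For every integer α ≥ 1 there exists ε₀ > 0 such that for all ε with 0 < ε ≤ ε₀ and all integers i, j with 1 ≤ i, j ≤ 2α and i ≠ j, the slab of the needle segment [p_i, p′_i] is disjoint from the needle segment [p_j, p′_j]. -/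
open RealInnerProductSpace

noncomputable section

/-- The slab of the segment `[x, y]`: points whose orthogonal projection onto the line
through `x` and `y` lies in the segment `[x, y]`. -/
def slab (x y : E2) : Set E2 :=
  {z | 0 ≤ ⟪z - x, y - x⟫ ∧ ⟪z - x, y - x⟫ ≤ ⟪y - x, y - x⟫}

/-- The point `p i = (2α + 1, −i²/(2α − i + 1))`, the intersection of `L i` with the
vertical line `x = 2α + 1`. -/
def needleP (α i : ℕ) : E2 :=
  pt (2 * (α : ℝ) + 1) (-(i : ℝ) ^ 2 / (2 * (α : ℝ) - (i : ℝ) + 1))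

/-- The point `p′ i = (2α + 1 − ε, −i²/(2α − i + 1) − ε(2α − i + 1)/i)`; the needle of
index `i` is the segment `[p i, p′ i]`, which is perpendicular to `L i`. -/
def needleP' (α : ℕ) (ε : ℝ) (i : ℕ) : E2 :=
  pt (2 * (α : ℝ) + 1 - ε)
    (-(i : ℝ) ^ 2 / (2 * (α : ℝ) - (i : ℝ) + 1) - ε * (2 * (α : ℝ) - (i : ℝ) + 1) / (i : ℝ))

/-- Values of `x ↦ x² / (N - x + 1)` at distinct naturals in `[1, N]` are at least `1 / N` apart. -/
lemma one_div_le_abs_sq_div_sub_sq_div (N : ℝ) (i j : ℕ) (hi : 1 ≤ i) (hiN : (i : ℝ) ≤ N)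
    (hj : 1 ≤ j) (hjN : (j : ℝ) ≤ N) (hij : i ≠ j) :
    1 / N ≤ |(i : ℝ) ^ 2 / (N - i + 1) - (j : ℝ) ^ 2 / (N - j + 1)| := by
  wlog h : j < i generalizing i j
  · rw [abs_sub_comm]
    exact this j i hj hjN hi hiN hij.symm (by omega)
  have hi1 : (1 : ℝ) ≤ i := by exact_mod_cast hi
  have hj1 : (1 : ℝ) ≤ j := by exact_mod_cast hj
  have hji : (j : ℝ) + 1 ≤ i := by exact_mod_cast h
  refine le_trans ?_ (le_abs_self _)
  have h1 : (i : ℝ) ^ 2 / (N - j + 1) ≤ (i : ℝ) ^ 2 / (N - i + 1) := by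
    apply div_le_div_of_nonneg_left <;> nlinarith
  have h2 : 1 / N ≤ ((i : ℝ) ^ 2 - (j : ℝ) ^ 2) / (N - j + 1) := by
    apply div_le_div₀ <;> nlinarith
  rw [sub_div] at h2
  linarith

/-- The slope `(N - x + 1) / x` of a needle lies in `[1 / N, N]`. -/
lemma needle_slope_bounds {N x : ℝ} (hx : 1 ≤ x) (hxN : x ≤ N) :
    1 / N ≤ (N - x + 1) / x ∧ (N - x + 1) / x ≤ N := by
  constructor
  · apply div_le_div₀ <;> linarith
  · rw [div_le_iff₀ (by linarith)]
    nlinarith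

/-- Real-coordinate form of the separation: a point at parameter `t` of a needle of slope `n`
misses the slab of a needle of slope `m` whose base is at signed vertical distance `D`. -/
lemma not_mem_slab_coords {N ε m n D t : ℝ} (hN : 1 ≤ N) (hε : 0 < ε)
    (hε₀ : ε ≤ 1 / (2 * N ^ 2 * (1 + N ^ 2))) (hm : 1 / N ≤ m) (hmN : m ≤ N)
    (hn : 1 / N ≤ n) (hnN : n ≤ N) (hD : 1 / N ≤ |D|) (ht : 0 ≤ t) (ht1 : t ≤ 1)
    (h0 : 0 ≤ t * ε * (1 + m * n) - m * D)
    (h1 : t * ε * (1 + m * n) - m * D ≤ ε * (1 + m ^ 2)) : False := by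
  have hN0 : 0 < 1 / N := by positivity
  have hm0 : 0 < m := by linarith
  have hn0 : 0 < n := by linarith
  have hmn : m * n ≤ N ^ 2 := by nlinarith
  have hmm : m ^ 2 ≤ N ^ 2 := by nlinarith
  have hb : ε * (1 + N ^ 2) ≤ 1 / N * (1 / N) / 2 := by
    calc ε * (1 + N ^ 2) ≤ 1 / (2 * N ^ 2 * (1 + N ^ 2)) * (1 + N ^ 2) := by gcongr
      _ = 1 / N * (1 / N) / 2 := by field_simp
  have hmD : 1 / N * (1 / N) ≤ m * |D| := by gcongr
  have hsq : 0 < 1 / N * (1 / N) := by positivity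
  have hte : t * ε * (1 + m * n) ≤ ε * (1 + N ^ 2) := by
    calc t * ε * (1 + m * n) ≤ 1 * ε * (1 + N ^ 2) := by gcongr
      _ = ε * (1 + N ^ 2) := by ring
  have hte0 : 0 ≤ t * ε * (1 + m * n) := by positivity
  have hem : ε * (1 + m ^ 2) ≤ ε * (1 + N ^ 2) := by gcongr
  rcases abs_cases D with ⟨h, _⟩ | ⟨h, _⟩ <;> rw [h] at hmD <;> linarith

/-- For every integer `α ≥ 1` there is `ε₀ > 0` such that for all
`0 < ε ≤ ε₀` and all distinct indices `1 ≤ i, j ≤ 2α`, the slab of the needle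
`[p i, p′ i]` is disjoint from the needle segment `[p j, p′ j]`. -/
theorem needle_slab_disjoint_other_needles :
    ∀ α : ℕ, 1 ≤ α → ∃ ε₀ : ℝ, 0 < ε₀ ∧ ∀ ε : ℝ, 0 < ε → ε ≤ ε₀ →
      ∀ i j : ℕ, 1 ≤ i → i ≤ 2 * α → 1 ≤ j → j ≤ 2 * α → i ≠ j →
        slab (needleP α i) (needleP' α ε i)
          ∩ segment ℝ (needleP α j) (needleP' α ε j) = ∅ := by
  intro α hα
  have hN : (1 : ℝ) ≤ 2 * α := by
    have : (1 : ℝ) ≤ α := by exact_mod_cast hα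
    linarith
  refine ⟨1 / (2 * (2 * (α : ℝ)) ^ 2 * (1 + (2 * (α : ℝ)) ^ 2)), by positivity, ?_⟩
  intro ε hε hε₀ i j hi hiα hj hjα hij
  have hiN : (i : ℝ) ≤ 2 * α := by exact_mod_cast hiα
  have hjN : (j : ℝ) ≤ 2 * α := by exact_mod_cast hjα
  rw [Set.eq_empty_iff_forall_notMem]
  rintro z ⟨⟨h0, h1⟩, hz⟩
  rw [segment_eq_image'] at hz
  obtain ⟨t, ⟨ht, ht1⟩, rfl⟩ := hz
  obtain ⟨hm, hmN⟩ := needle_slope_bounds (Nat.one_le_cast.mpr hi) hiN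
  obtain ⟨hn, hnN⟩ := needle_slope_bounds (Nat.one_le_cast.mpr hj) hjN
  have hD := one_div_le_abs_sq_div_sub_sq_div (2 * α : ℝ) i j hi hiN hj hjN hij
  simp only [needleP, needleP', pt, PiLp.inner_apply, Fin.sum_univ_two, WithLp.equiv_symm_apply,
    PiLp.sub_apply, PiLp.add_apply, PiLp.smul_apply, Matrix.cons_val_zero, Matrix.cons_val_one,
    Matrix.cons_val_fin_one, RCLike.inner_apply, conj_trivial, smul_eq_mul, neg_div, mul_div_assoc]
    at h0 h1
  generalize (2 * (α : ℝ) - i + 1) / i = m at *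
  generalize (2 * (α : ℝ) - j + 1) / j = n at *
  generalize (i : ℝ) ^ 2 / (2 * (α : ℝ) - i + 1) = a at *
  generalize (j : ℝ) ^ 2 / (2 * (α : ℝ) - j + 1) = b at *
  refine not_mem_slab_coords hN hε hε₀ hm hmN hn hnN hD ht ht1 ?_ ?_
  · refine nonneg_of_mul_nonneg_right (a := ε) (le_of_le_of_eq h0 ?_) hε
    ring
  · refine le_of_mul_le_mul_left (a := ε) ?_ hε
    linarith
end
end
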